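/- arXiv:2204.04493 — 2 statements merged into one kernel-verified Lean document; each statement's English description precedes it below -/
import Mathlib

section
/- Existence of entanglement-invertible channels between multimatrix algebras of equal dimension. Let A = ∏_{i<m} M_{a_i}(ℂ) and B = ∏_{j<n} M_{b_j}(ℂ) be multimatrix algebras. There exist h ≥ 1 and a channel M : A⊗M_h(ℂ) → B which is entanglement-invertible with respect to the canonical maximally entangled state |Ω_h⟩⟨Ω_h| of M_h(ℂ)⊗M_h(ℂ) if and only if dim A = dim B, i.e. ∑_{i<m} a_i² = ∑_{j<n} b_j². -/
noncomputable section

open Matrix Kronecker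
open scoped ComplexOrder

namespace EntInvPaper

/-- The matrix algebra `M_n(ℂ)` with row/column index type `n`. -/
abbrev Mat (n : Type) : Type := Matrix n n ℂ

/-- The amplification `id_{M_t} ⊗ Φ` of a linear map between matrix algebras,
as a plain function on matrices. -/
def amplL {n m : Type} (t : Type) (Φ : Mat n →ₗ[ℂ] Mat m) (X : Mat (t × n)) : Mat (t × m) :=
  Matrix.of fun p q => Φ (Matrix.of fun x y => X (p.1, x) (q.1, y)) p.2 q.2

/-- The amplification `Φ ⊗ id_{M_t}` of a linear map between matrix algebras. -/
def amplR {n m : Type} (t : Type) (Φ : Mat n →ₗ[ℂ] Mat m) (X : Mat (n × t)) : Mat (m × t) :=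
  Matrix.of fun p q => Φ (Matrix.of fun x y => X (x, p.2) (y, q.2)) p.1 q.1

/-- Complete positivity: every amplification `id_{M_k} ⊗ Φ` preserves positive
semidefiniteness. -/
def IsCP {n m : Type} [Fintype n] [Fintype m] (Φ : Mat n →ₗ[ℂ] Mat m) : Prop :=
  ∀ (k : ℕ) (X : Mat (Fin k × n)), X.PosSemidef → (amplL (Fin k) Φ X).PosSemidef

/-- A channel is a completely positive trace-preserving linear map. -/
def IsChannel {n m : Type} [Fintype n] [Fintype m] (Φ : Mat n →ₗ[ℂ] Mat m) : Prop :=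
  IsCP Φ ∧ ∀ X : Mat n, (Φ X).trace = X.trace

/-- A state: a positive semidefinite matrix of trace one. -/
def IsState {n : Type} [Fintype n] (ρ : Mat n) : Prop :=
  ρ.PosSemidef ∧ ρ.trace = 1

/-- The outer product `|v⟩⟨v|`. -/
def outer {n : Type} (v : n → ℂ) : Mat n :=
  Matrix.vecMulVec v (star v)

/-- `x ⊗ W`, with the tensor factors regrouped as `(a × h₁) × h₂`. -/
def tensorState {a h₁ h₂ : Type} (x : Mat a) (W : Mat (h₁ × h₂)) : Mat ((a × h₁) × h₂) :=
  Matrix.reindex (Equiv.prodAssoc a h₁ h₂).symm (Equiv.prodAssoc a h₁ h₂).symm (x ⊗ₖ W)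

/-- Swap the two tensor factors of a bipartite operator. -/
def swapState {h₁ h₂ : Type} (W : Mat (h₁ × h₂)) : Mat (h₂ × h₁) :=
  Matrix.reindex (Equiv.prodComm h₁ h₂) (Equiv.prodComm h₁ h₂) W

/-- Partial trace over the first tensor factor. -/
def ptraceFst {p t : Type} [Fintype p] (X : Mat (p × t)) : Mat t :=
  Matrix.of fun s s' => ∑ u : p, X (u, s) (u, s')

/-- Partial trace over the second tensor factor. -/
def ptraceSnd {s t : Type} [Fintype t] (X : Mat (s × t)) : Mat s :=
  Matrix.of fun i i' => ∑ k : t, X (i, k) (i', k)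

/-- `N` is an entanglement-left inverse of `M` with respect to the resource state `W`:
`N((M ⊗ id)(x ⊗ W)) = x` for all `x`. -/
def EntLeftInv {a b h₁ h₂ : Type} (M : Mat (a × h₁) →ₗ[ℂ] Mat b)
    (N : Mat (b × h₂) →ₗ[ℂ] Mat a) (W : Mat (h₁ × h₂)) : Prop :=
  ∀ x : Mat a, N (amplR h₂ M (tensorState x W)) = x

/-- `N` is an entanglement-right inverse of `M` with respect to `W`:
`M((N ⊗ id)(y ⊗ Wᵠ)) = y` for all `y`, where `Wᵠ` is `W` with the factors swapped. -/
def EntRightInv {a b h₁ h₂ : Type} (M : Mat (a × h₁) →ₗ[ℂ] Mat b)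
    (N : Mat (b × h₂) →ₗ[ℂ] Mat a) (W : Mat (h₁ × h₂)) : Prop :=
  ∀ y : Mat b, M (amplR h₁ N (tensorState y (swapState W))) = y

/-- `M` is entanglement-reversible with respect to `W`. -/
def EntReversible {a b h₁ h₂ : Type} [Fintype a] [Fintype b] [Fintype h₁] [Fintype h₂]
    (M : Mat (a × h₁) →ₗ[ℂ] Mat b) (W : Mat (h₁ × h₂)) : Prop :=
  ∃ N : Mat (b × h₂) →ₗ[ℂ] Mat a, IsChannel N ∧ EntLeftInv M N W

/-- `M` is entanglement-invertible with respect to `W`. -/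
def EntInvertible {a b h₁ h₂ : Type} [Fintype a] [Fintype b] [Fintype h₁] [Fintype h₂]
    (M : Mat (a × h₁) →ₗ[ℂ] Mat b) (W : Mat (h₁ × h₂)) : Prop :=
  ∃ N : Mat (b × h₂) →ₗ[ℂ] Mat a, IsChannel N ∧ EntLeftInv M N W ∧ EntRightInv M N W

/-- The canonical maximally entangled unit vector `Ω = (1/√h) ∑ₖ eₖ ⊗ eₖ`. -/
def omegaVec (h : ℕ) : Fin h × Fin h → ℂ :=
  fun p => if p.1 = p.2 then ((Real.sqrt h : ℝ) : ℂ)⁻¹ else 0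

/-- The canonical maximally entangled state `|Ω⟩⟨Ω|`. -/
def canME (h : ℕ) : Mat (Fin h × Fin h) := outer (omegaVec h)

/-- The vector `w_ω = ∑ₖ eₖ ⊗ ω eₖ` associated to a linear map `ω : ℂ^{h₁} → ℂ^{h₂}`. -/
def pureVec {h₁ h₂ : Type} (ω : Matrix h₂ h₁ ℂ) : h₁ × h₂ → ℂ := fun p => ω p.2 p.1

/-- The pure state `|w_ω⟩⟨w_ω|` defined by `ω`. -/
def pureState {h₁ h₂ : Type} (ω : Matrix h₂ h₁ ℂ) : Mat (h₁ × h₂) := outer (pureVec ω)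

/-- `V` is a Stinespring dilation of the channel `M`, with environment the second
tensor factor `ℂ^e`: `V` is an isometry and `M z = Tr_{ℂ^e}(V z V†)`. -/
def IsDilation {a h b e : ℕ} (M : Mat (Fin a × Fin h) →ₗ[ℂ] Mat (Fin b))
    (V : Matrix (Fin b × Fin e) (Fin a × Fin h) ℂ) : Prop :=
  Vᴴ * V = 1 ∧ ∀ z : Mat (Fin a × Fin h), M z = ptraceSnd (V * z * Vᴴ)

/-- Minimality of a dilation: the vectors `(⟨y| ⊗ I)Vξ` span the environment. -/
def IsMinimalDilation {a h b e : ℕ} (V : Matrix (Fin b × Fin e) (Fin a × Fin h) ℂ) : Prop :=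
  Submodule.span ℂ { v : Fin e → ℂ |
    ∃ (y : Fin b → ℂ) (ξ : Fin a × Fin h → ℂ),
      v = fun f => ∑ j, (starRingEnd ℂ) (y j) * (V *ᵥ ξ) (j, f) } = ⊤

/-- The rearrangement `Ṽ` of `V : ℂ^a ⊗ ℂ^h → ℂ^b ⊗ ℂ^e`, with entries
`Ṽ_{(k,j),(i,f)} = V_{(j,f),(i,k)}`. -/
def rearrange {a b h e : ℕ} (V : Matrix (Fin b × Fin e) (Fin a × Fin h) ℂ) :
    Matrix (Fin h × Fin b) (Fin a × Fin e) ℂ :=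
  Matrix.of fun p q => V (p.2, q.2) (q.1, p.1)

/-- The candidate bi-isometry `S = (ω ⊗ I_b) · Ṽ · (I_a ⊗ κ)`. -/
def biIsometryCandidate {a b h e : ℕ} (ω : Mat (Fin h))
    (V : Matrix (Fin b × Fin e) (Fin a × Fin h) ℂ) (κ : Mat (Fin e)) :
    Matrix (Fin h × Fin b) (Fin a × Fin e) ℂ :=
  (ω ⊗ₖ (1 : Mat (Fin b))) * rearrange V * ((1 : Mat (Fin a)) ⊗ₖ κ)

/-- The contraction `(⟨Φ| ⊗ I)X(|Φ⟩ ⊗ I)` of the first tensor factor of `X`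
against the vector `Φ`. -/
def contract {p t : Type} [Fintype p] (Φ : p → ℂ) (X : Mat (p × t)) : Mat t :=
  Matrix.of fun s s' => ∑ u : p, ∑ u' : p, (starRingEnd ℂ) (Φ u) * X (u, s) (u', s') * Φ u'

/-- Conjugation `X ↦ C X C†` as a linear map. -/
def conjBy {p q : Type} [Fintype q] (C : Matrix p q ℂ) : Mat q →ₗ[ℂ] Mat p where
  toFun X := C * X * Cᴴ
  map_add' X Y := by
    show C * (X + Y) * Cᴴ = C * X * Cᴴ + C * Y * Cᴴ
    rw [Matrix.mul_add, Matrix.add_mul]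
  map_smul' c X := by
    show C * (c • X) * Cᴴ = c • (C * X * Cᴴ)
    rw [Matrix.mul_smul, Matrix.smul_mul]

end EntInvPaper

noncomputable section

open Matrix Kronecker
open scoped ComplexOrder

namespace EntInvPaper

/-- Amplification `Φ ⊗ id_{M_t}` for a linear map between multimatrix algebras. -/
def piAmplR {ι κ : Type} {A : ι → Type} {B : κ → Type} (t : Type)
    (Φ : ((i : ι) → Mat (A i)) →ₗ[ℂ] (j : κ) → Mat (B j))
    (X : (i : ι) → Mat (A i × t)) : (j : κ) → Mat (B j × t) :=
  fun j => Matrix.of fun p q =>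
    Φ (fun i => Matrix.of fun x y => X i (x, p.2) (y, q.2)) j p.1 q.1

/-- Amplification `id_{M_t} ⊗ Φ` for a linear map between multimatrix algebras. -/
def piAmplL {ι κ : Type} {A : ι → Type} {B : κ → Type} (t : Type)
    (Φ : ((i : ι) → Mat (A i)) →ₗ[ℂ] (j : κ) → Mat (B j))
    (X : (i : ι) → Mat (t × A i)) : (j : κ) → Mat (t × B j) :=
  fun j => Matrix.of fun p q =>
    Φ (fun i => Matrix.of fun x y => X i (p.1, x) (q.1, y)) j p.2 q.2

/-- Complete positivity for maps between multimatrix algebras. -/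
def PiIsCP {ι κ : Type} {A : ι → Type} {B : κ → Type}
    [∀ i, Fintype (A i)] [∀ j, Fintype (B j)]
    (Φ : ((i : ι) → Mat (A i)) →ₗ[ℂ] (j : κ) → Mat (B j)) : Prop :=
  ∀ (k : ℕ) (X : (i : ι) → Mat (Fin k × A i)),
    (∀ i, (X i).PosSemidef) → ∀ j, (piAmplL (Fin k) Φ X j).PosSemidef

/-- A channel between multimatrix algebras: completely positive and preserving
the total trace. -/
def PiIsChannel {ι κ : Type} [Fintype ι] [Fintype κ] {A : ι → Type} {B : κ → Type}
    [∀ i, Fintype (A i)] [∀ j, Fintype (B j)]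
    (Φ : ((i : ι) → Mat (A i)) →ₗ[ℂ] (j : κ) → Mat (B j)) : Prop :=
  PiIsCP Φ ∧ ∀ X, ∑ j, (Φ X j).trace = ∑ i, (X i).trace

/-- A positive semidefinite element of a multimatrix algebra of total trace one. -/
def PiIsState {ι : Type} [Fintype ι] {A : ι → Type} [∀ i, Fintype (A i)]
    (ρ : (i : ι) → Mat (A i)) : Prop :=
  (∀ i, (ρ i).PosSemidef) ∧ ∑ i, (ρ i).trace = 1

/-- `N` is an entanglement-left inverse of `M : A ⊗ M_{h₁} → B` with respect to
the resource state `W`. -/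
def PiEntLeftInv {m n h₁ h₂ : ℕ} {a : Fin m → ℕ} {b : Fin n → ℕ}
    (M : ((i : Fin m) → Mat (Fin (a i) × Fin h₁)) →ₗ[ℂ] (j : Fin n) → Mat (Fin (b j)))
    (N : ((j : Fin n) → Mat (Fin (b j) × Fin h₂)) →ₗ[ℂ] (i : Fin m) → Mat (Fin (a i)))
    (W : Mat (Fin h₁ × Fin h₂)) : Prop :=
  ∀ x : (i : Fin m) → Mat (Fin (a i)),
    N (piAmplR (Fin h₂) M fun i => tensorState (x i) W) = x

/-- `N` is an entanglement-right inverse of `M` with respect to `W`. -/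
def PiEntRightInv {m n h₁ h₂ : ℕ} {a : Fin m → ℕ} {b : Fin n → ℕ}
    (M : ((i : Fin m) → Mat (Fin (a i) × Fin h₁)) →ₗ[ℂ] (j : Fin n) → Mat (Fin (b j)))
    (N : ((j : Fin n) → Mat (Fin (b j) × Fin h₂)) →ₗ[ℂ] (i : Fin m) → Mat (Fin (a i)))
    (W : Mat (Fin h₁ × Fin h₂)) : Prop :=
  ∀ y : (j : Fin n) → Mat (Fin (b j)),
    M (piAmplR (Fin h₁) N fun j => tensorState (y j) (swapState W)) = y

/-- `M` is entanglement-reversible with respect to `W`. -/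
def PiEntReversible {m n h₁ h₂ : ℕ} {a : Fin m → ℕ} {b : Fin n → ℕ}
    (M : ((i : Fin m) → Mat (Fin (a i) × Fin h₁)) →ₗ[ℂ] (j : Fin n) → Mat (Fin (b j)))
    (W : Mat (Fin h₁ × Fin h₂)) : Prop :=
  ∃ N : ((j : Fin n) → Mat (Fin (b j) × Fin h₂)) →ₗ[ℂ] (i : Fin m) → Mat (Fin (a i)),
    PiIsChannel N ∧ PiEntLeftInv M N W

/-- `M` is entanglement-invertible with respect to `W`. -/
def PiEntInvertible {m n h₁ h₂ : ℕ} {a : Fin m → ℕ} {b : Fin n → ℕ}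
    (M : ((i : Fin m) → Mat (Fin (a i) × Fin h₁)) →ₗ[ℂ] (j : Fin n) → Mat (Fin (b j)))
    (W : Mat (Fin h₁ × Fin h₂)) : Prop :=
  ∃ N : ((j : Fin n) → Mat (Fin (b j) × Fin h₂)) →ₗ[ℂ] (i : Fin m) → Mat (Fin (a i)),
    PiIsChannel N ∧ PiEntLeftInv M N W ∧ PiEntRightInv M N W

end EntInvPaper

noncomputable section

open Matrix Kronecker
open scoped ComplexOrder
namespace EntInvPaper

/-- A completely positive map between multimatrix algebras stays positive after amplification by
an arbitrary finite index type. -/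
theorem PiIsCP.piAmplL_posSemidef {ι κ : Type} {A : ι → Type} {B : κ → Type}
    [∀ i, Fintype (A i)] [∀ j, Fintype (B j)]
    {Φ : ((i : ι) → Mat (A i)) →ₗ[ℂ] (j : κ) → Mat (B j)} (hΦ : PiIsCP Φ)
    {T : Type} [Fintype T] {X : (i : ι) → Mat (T × A i)} (hX : ∀ i, (X i).PosSemidef) (j : κ) :
    (piAmplL T Φ X j).PosSemidef := by
  let e := Fintype.equivFin T
  have key := (hΦ (Fintype.card T)
    (fun i => (X i).submatrix (Prod.map e.symm id) (Prod.map e.symm id))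
    (fun i => (hX i).submatrix _) j).submatrix (Prod.map e id)
  convert key using 1
  ext p q
  simp [piAmplL]

theorem PiIsCP.piAmplR_posSemidef {ι κ : Type} {A : ι → Type} {B : κ → Type}
    [∀ i, Fintype (A i)] [∀ j, Fintype (B j)]
    {Φ : ((i : ι) → Mat (A i)) →ₗ[ℂ] (j : κ) → Mat (B j)} (hΦ : PiIsCP Φ)
    {T : Type} [Fintype T] {X : (i : ι) → Mat (A i × T)} (hX : ∀ i, (X i).PosSemidef) (j : κ) :
    (piAmplR T Φ X j).PosSemidef :=
  (hΦ.piAmplL_posSemidef (fun i => (hX i).submatrix Prod.swap) j).submatrix Prod.swap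

theorem PiIsCP.apply_posSemidef {ι κ : Type} {A : ι → Type} {B : κ → Type}
    [∀ i, Fintype (A i)] [∀ j, Fintype (B j)]
    {Φ : ((i : ι) → Mat (A i)) →ₗ[ℂ] (j : κ) → Mat (B j)} (hΦ : PiIsCP Φ)
    {X : (i : ι) → Mat (A i)} (hX : ∀ i, (X i).PosSemidef) (j : κ) :
    (Φ X j).PosSemidef :=
  (hΦ.piAmplL_posSemidef (T := Unit) (fun i => (hX i).submatrix Prod.snd) j).submatrix
    (fun x => ((), x))

/-- The linear map with Kraus operators `K i j k`. -/
def krausMap {ι κ : Type} [Fintype ι] {A : ι → Type} {B : κ → Type} [∀ i, Fintype (A i)]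
    {E : ι → κ → Type} [∀ i j, Fintype (E i j)]
    (K : (i : ι) → (j : κ) → E i j → Matrix (B j) (A i) ℂ) :
    ((i : ι) → Mat (A i)) →ₗ[ℂ] (j : κ) → Mat (B j) :=
  LinearMap.pi fun j => ∑ i, ∑ k, conjBy (K i j k) ∘ₗ LinearMap.proj i

theorem krausMap_apply {ι κ : Type} [Fintype ι] {A : ι → Type} {B : κ → Type}
    [∀ i, Fintype (A i)] {E : ι → κ → Type} [∀ i j, Fintype (E i j)]
    (K : (i : ι) → (j : κ) → E i j → Matrix (B j) (A i) ℂ) (X : (i : ι) → Mat (A i)) (j : κ) :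
    krausMap K X j = ∑ i, ∑ k, K i j k * X i * (K i j k)ᴴ := by
  simp [krausMap, conjBy, LinearMap.sum_apply]

theorem krausMap_isCP {ι κ : Type} [Fintype ι] {A : ι → Type} {B : κ → Type}
    [∀ i, Fintype (A i)] [∀ j, Fintype (B j)] {E : ι → κ → Type} [∀ i j, Fintype (E i j)]
    (K : (i : ι) → (j : κ) → E i j → Matrix (B j) (A i) ℂ) : PiIsCP (krausMap K) := by
  intro n X hX j
  have key : piAmplL (Fin n) (krausMap K) X j =
      ∑ i, ∑ k, ((1 : Mat (Fin n)) ⊗ₖ K i j k) * X i * ((1 : Mat (Fin n)) ⊗ₖ K i j k)ᴴ := by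
    ext p q
    simp only [piAmplL, krausMap_apply, Matrix.of_apply, Matrix.sum_apply]
    refine Finset.sum_congr rfl fun i _ => Finset.sum_congr rfl fun k _ => ?_
    simp [Matrix.mul_apply, Fintype.sum_prod_type, Matrix.kroneckerMap_apply, Matrix.one_apply,
      ite_mul, apply_ite, Finset.sum_ite_irrel]
  rw [key]
  exact Matrix.posSemidef_sum _ fun i _ => Matrix.posSemidef_sum _ fun k _ =>
    (hX i).mul_mul_conjTranspose_same _

theorem krausMap_isChannel {ι κ : Type} [Fintype ι] [Fintype κ] {A : ι → Type} {B : κ → Type}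
    [∀ i, Fintype (A i)] [∀ i, DecidableEq (A i)] [∀ j, Fintype (B j)]
    {E : ι → κ → Type} [∀ i j, Fintype (E i j)]
    (K : (i : ι) → (j : κ) → E i j → Matrix (B j) (A i) ℂ)
    (hK : ∀ i, ∑ j, ∑ k, (K i j k)ᴴ * K i j k = 1) : PiIsChannel (krausMap K) := by
  refine ⟨krausMap_isCP K, fun X => ?_⟩
  simp only [krausMap_apply, Matrix.trace_sum]
  rw [Finset.sum_comm]
  refine Finset.sum_congr rfl fun i _ => ?_
  calc ∑ j, ∑ k, (K i j k * X i * (K i j k)ᴴ).trace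
      = ((∑ j, ∑ k, (K i j k)ᴴ * K i j k) * X i).trace := by
        simp only [Matrix.sum_mul, Matrix.trace_sum]
        refine Finset.sum_congr rfl fun j _ => Finset.sum_congr rfl fun k _ => ?_
        rw [Matrix.trace_mul_comm, ← Matrix.mul_assoc]
    _ = (X i).trace := by rw [hK, Matrix.one_mul]

theorem canME_apply {h : ℕ} (s t s' t' : Fin h) :
    canME h (s, t) (s', t') = if s = t ∧ s' = t' then (h : ℂ)⁻¹ else 0 := by
  have hh : ((Real.sqrt h : ℝ) : ℂ) * ((Real.sqrt h : ℝ) : ℂ) = h := by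
    rw [← Complex.ofReal_mul, Real.mul_self_sqrt (Nat.cast_nonneg h), Complex.ofReal_natCast]
  simp only [canME, outer, omegaVec, Matrix.vecMulVec_apply, Pi.star_apply]
  by_cases h1 : s = t <;> by_cases h2 : s' = t' <;> simp [h1, h2]
  rw [← mul_inv, hh]

theorem swapState_canME (h : ℕ) : swapState (canME h) = canME h := by
  ext ⟨s, t⟩ ⟨s', t'⟩
  simp [swapState, canME_apply, eq_comm]

theorem piEntRightInv_canME_iff {m n h : ℕ} {a : Fin m → ℕ} {b : Fin n → ℕ}
    {M : ((i : Fin m) → Mat (Fin (a i) × Fin h)) →ₗ[ℂ] (j : Fin n) → Mat (Fin (b j))}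
    {N : ((j : Fin n) → Mat (Fin (b j) × Fin h)) →ₗ[ℂ] (i : Fin m) → Mat (Fin (a i))} :
    PiEntRightInv M N (canME h) ↔ PiEntLeftInv N M (canME h) := by
  rw [PiEntRightInv, PiEntLeftInv, swapState_canME]

theorem tensorState_apply {a h₁ h₂ : Type} (x : Mat a) (W : Mat (h₁ × h₂))
    (p q : (a × h₁) × h₂) :
    tensorState x W p q = x p.1.1 q.1.1 * W (p.1.2, p.2) (q.1.2, q.2) := rfl

/-- Two families of Kraus operators whose contractions over the entangled resource are scalar
define entanglement-inverse maps. -/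
theorem krausMap_entLeftInv {m n h : ℕ} {a : Fin m → ℕ} {b : Fin n → ℕ}
    {E : Fin m → Fin n → Type} [∀ i j, Fintype (E i j)]
    {F : Fin n → Fin m → Type} [∀ j i, Fintype (F j i)]
    (K : (i : Fin m) → (j : Fin n) → E i j → Matrix (Fin (b j)) (Fin (a i) × Fin h) ℂ)
    (L : (j : Fin n) → (i : Fin m) → F j i → Matrix (Fin (a i)) (Fin (b j) × Fin h) ℂ)
    (c : (i : Fin m) → (j : Fin n) → E i j → F j i → ℂ)
    (hdiag : ∀ i j k l p p', ∑ q, ∑ t, L j i l p (q, t) * K i j k q (p', t) =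
      if p = p' then c i j k l else 0)
    (hoff : ∀ i i' j k l p p', i ≠ i' →
      ∑ q, ∑ t, L j i l p (q, t) * K i' j k q (p', t) = 0)
    (hc : ∀ i, ∑ j, ∑ k, ∑ l, c i j k l * star (c i j k l) = h) (hh : h ≠ 0) :
    PiEntLeftInv (krausMap K) (krausMap L) (canME h) := by
  intro x
  let Kt (i : Fin m) (j : Fin n) (k : E i j) : Matrix (Fin (b j) × Fin h) (Fin (a i)) ℂ :=
    Matrix.of fun q p => K i j k q.1 (p, q.2)
  have hM : ∀ j, piAmplR (Fin h) (krausMap K) (fun i => tensorState (x i) (canME h)) j =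
      (h : ℂ)⁻¹ • ∑ i, ∑ k, Kt i j k * x i * (Kt i j k)ᴴ := by
    intro j
    ext ⟨q, t⟩ ⟨q', t'⟩
    simp only [piAmplR, krausMap_apply, Matrix.of_apply, Matrix.sum_apply, Matrix.smul_apply,
      Finset.smul_sum]
    refine Finset.sum_congr rfl fun i _ => Finset.sum_congr rfl fun k _ => ?_
    simp only [Matrix.mul_apply, Fintype.sum_prod_type, tensorState_apply, canME_apply,
      Matrix.of_apply, Matrix.conjTranspose_apply, Kt, smul_eq_mul, Finset.mul_sum,
      Finset.sum_mul, mul_ite, ite_mul, mul_zero, zero_mul, ite_and]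
    simp only [Finset.sum_ite_eq', Finset.mem_univ, if_true, Finset.sum_ite_irrel,
      Finset.sum_const_zero]
    refine Finset.sum_congr rfl fun p _ => ?_
    refine Finset.sum_congr rfl fun p' _ => ?_
    ring
  have hdiag' : ∀ i j k l, L j i l * Kt i j k = c i j k l • 1 := by
    intro i j k l
    ext p p'
    simp [Matrix.mul_apply, Fintype.sum_prod_type, Kt, hdiag, Matrix.one_apply]
  have hoff' : ∀ i i' j k l, i ≠ i' → L j i l * Kt i' j k = 0 := by
    intro i i' j k l hi
    ext p p'
    simp [Matrix.mul_apply, Fintype.sum_prod_type, Kt, hoff _ _ _ _ _ _ _ hi]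
  funext i
  have hsum : ∀ j l, L j i l * (∑ i', ∑ k, Kt i' j k * x i' * (Kt i' j k)ᴴ) * (L j i l)ᴴ =
      (∑ k, c i j k l * star (c i j k l)) • x i := by
    intro j l
    simp only [Matrix.mul_sum, Matrix.sum_mul]
    rw [Finset.sum_eq_single i, Finset.sum_smul]
    · refine Finset.sum_congr rfl fun k _ => ?_
      calc L j i l * (Kt i j k * x i * (Kt i j k)ᴴ) * (L j i l)ᴴ
          = (L j i l * Kt i j k) * x i * (L j i l * Kt i j k)ᴴ := by
            simp only [Matrix.conjTranspose_mul, Matrix.mul_assoc]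
        _ = _ := by rw [hdiag']; simp [smul_smul, mul_comm]
    · intro i' _ hi
      refine Finset.sum_eq_zero fun k _ => ?_
      calc L j i l * (Kt i' j k * x i' * (Kt i' j k)ᴴ) * (L j i l)ᴴ
          = (L j i l * Kt i' j k) * x i' * (L j i l * Kt i' j k)ᴴ := by
            simp only [Matrix.conjTranspose_mul, Matrix.mul_assoc]
        _ = 0 := by rw [hoff' _ _ _ _ _ hi.symm]; simp
    · simp
  rw [krausMap_apply]
  simp only [hM, Matrix.mul_smul, Matrix.smul_mul, hsum]
  simp only [smul_smul, ← Finset.sum_smul, ← Finset.mul_sum]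
  have := hc i
  simp only [Finset.sum_comm (s := (Finset.univ : Finset (E i _)))] at this
  rw [this, inv_mul_cancel₀ (by exact_mod_cast hh), one_smul]

/-- Sequential composition `M₂ ∘ (M₁ ⊗ id)` of maps assisted by the resources `Fin h₁` and
`Fin h₂`, with combined resource `Fin h` identified with `Fin h₁ × Fin h₂` through `e`. -/
def entComp {m n k h₁ h₂ h : ℕ} {a : Fin m → ℕ} {b : Fin n → ℕ} {c : Fin k → ℕ}
    (e : Fin h₁ × Fin h₂ ≃ Fin h)
    (M₁ : ((i : Fin m) → Mat (Fin (a i) × Fin h₁)) →ₗ[ℂ] (j : Fin k) → Mat (Fin (c j)))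
    (M₂ : ((j : Fin k) → Mat (Fin (c j) × Fin h₂)) →ₗ[ℂ] (l : Fin n) → Mat (Fin (b l))) :
    ((i : Fin m) → Mat (Fin (a i) × Fin h)) →ₗ[ℂ] (l : Fin n) → Mat (Fin (b l)) where
  toFun X := M₂ fun j => Matrix.of fun p q =>
    M₁ (fun i => Matrix.of fun x y => X i (x.1, e (x.2, p.2)) (y.1, e (y.2, q.2))) j p.1 q.1
  map_add' X Y := by
    rw [← map_add]
    congr 1
    ext j p q
    exact congrFun (congrFun (congrFun (map_add M₁ _ _) j) p.1) q.1
  map_smul' r X := by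
    rw [RingHom.id_apply, ← map_smul]
    congr 1
    ext j p q
    exact congrFun (congrFun (congrFun (map_smul M₁ r _) j) p.1) q.1

theorem entComp_apply {m n k h₁ h₂ h : ℕ} {a : Fin m → ℕ} {b : Fin n → ℕ} {c : Fin k → ℕ}
    (e : Fin h₁ × Fin h₂ ≃ Fin h)
    (M₁ : ((i : Fin m) → Mat (Fin (a i) × Fin h₁)) →ₗ[ℂ] (j : Fin k) → Mat (Fin (c j)))
    (M₂ : ((j : Fin k) → Mat (Fin (c j) × Fin h₂)) →ₗ[ℂ] (l : Fin n) → Mat (Fin (b l)))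
    (X : (i : Fin m) → Mat (Fin (a i) × Fin h)) :
    entComp e M₁ M₂ X = M₂ fun j => Matrix.of fun p q =>
      M₁ (fun i => Matrix.of fun x y => X i (x.1, e (x.2, p.2)) (y.1, e (y.2, q.2))) j p.1 q.1 :=
  rfl

theorem PiIsChannel.entComp {m n k h₁ h₂ h : ℕ} {a : Fin m → ℕ} {b : Fin n → ℕ}
    {c : Fin k → ℕ} (e : Fin h₁ × Fin h₂ ≃ Fin h)
    {M₁ : ((i : Fin m) → Mat (Fin (a i) × Fin h₁)) →ₗ[ℂ] (j : Fin k) → Mat (Fin (c j))}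
    {M₂ : ((j : Fin k) → Mat (Fin (c j) × Fin h₂)) →ₗ[ℂ] (l : Fin n) → Mat (Fin (b l))}
    (hM₁ : PiIsChannel M₁) (hM₂ : PiIsChannel M₂) : PiIsChannel (entComp e M₁ M₂) := by
  refine ⟨fun r X hX l => ?_, fun X => ?_⟩
  · have inner := fun j => (hM₁.1.piAmplL_posSemidef (T := Fin r × Fin h₂)
      (fun i => (hX i).submatrix
        (fun u : (Fin r × Fin h₂) × Fin (a i) × Fin h₁ =>
          (u.1.1, (u.2.1, e (u.2.2, u.1.2))))) j).submatrix
        (fun v : Fin r × Fin (c j) × Fin h₂ => ((v.1, v.2.2), v.2.1))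
    exact hM₂.1 r _ inner l
  · rw [entComp_apply, hM₂.2]
    simp only [Matrix.trace, Matrix.diag_apply, Matrix.of_apply, Fintype.sum_prod_type]
    have step : ∀ t : Fin h₂, ∑ j, ∑ p, M₁ (fun i => Matrix.of fun x y =>
        X i (x.1, e (x.2, t)) (y.1, e (y.2, t))) j p p =
        ∑ i, ∑ p, ∑ s, X i (p, e (s, t)) (p, e (s, t)) := fun t => by
      have := hM₁.2 (fun i => Matrix.of fun x y => X i (x.1, e (x.2, t)) (y.1, e (y.2, t)))
      simpa only [Matrix.trace, Matrix.diag_apply, Matrix.of_apply, Fintype.sum_prod_type]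
        using this
    calc _ = ∑ t : Fin h₂, ∑ j, ∑ p, M₁ (fun i => Matrix.of fun x y =>
            X i (x.1, e (x.2, t)) (y.1, e (y.2, t))) j p p := by
          rw [Finset.sum_comm]
          exact Finset.sum_congr rfl fun j _ => Finset.sum_comm
      _ = ∑ i, ∑ p, ∑ s, ∑ t, X i (p, e (s, t)) (p, e (s, t)) := by
          simp only [step]
          rw [Finset.sum_comm]
          refine Finset.sum_congr rfl fun i _ => ?_
          rw [Finset.sum_comm]
          exact Finset.sum_congr rfl fun p _ => Finset.sum_comm
      _ = _ := by
          refine Finset.sum_congr rfl fun i _ => Finset.sum_congr rfl fun p _ => ?_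
          rw [← Equiv.sum_comp e, Fintype.sum_prod_type]

theorem canME_prod {h₁ h₂ h : ℕ} (e : Fin h₁ × Fin h₂ ≃ Fin h)
    (s₁ t₁ s₁' t₁' : Fin h₁) (s₂ t₂ s₂' t₂' : Fin h₂) :
    canME h (e (s₁, s₂), e (t₁, t₂)) (e (s₁', s₂'), e (t₁', t₂')) =
      canME h₂ (s₂, t₂) (s₂', t₂') * canME h₁ (s₁, t₁) (s₁', t₁') := by
  have hh : h = h₁ * h₂ := by simpa using (Fintype.card_congr e).symm
  simp only [canME_apply, EmbeddingLike.apply_eq_iff_eq, Prod.mk.injEq]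
  subst hh
  split_ifs <;> simp_all [mul_comm]

theorem PiEntLeftInv.entComp {m n k h₁ h₂ h : ℕ} {a : Fin m → ℕ} {b : Fin n → ℕ}
    {c : Fin k → ℕ} (e : Fin h₁ × Fin h₂ ≃ Fin h)
    {M₁ : ((i : Fin m) → Mat (Fin (a i) × Fin h₁)) →ₗ[ℂ] (j : Fin k) → Mat (Fin (c j))}
    {N₁ : ((j : Fin k) → Mat (Fin (c j) × Fin h₁)) →ₗ[ℂ] (i : Fin m) → Mat (Fin (a i))}
    {M₂ : ((j : Fin k) → Mat (Fin (c j) × Fin h₂)) →ₗ[ℂ] (l : Fin n) → Mat (Fin (b l))}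
    {N₂ : ((l : Fin n) → Mat (Fin (b l) × Fin h₂)) →ₗ[ℂ] (j : Fin k) → Mat (Fin (c j))}
    (H₁ : PiEntLeftInv M₁ N₁ (canME h₁)) (H₂ : PiEntLeftInv M₂ N₂ (canME h₂)) :
    PiEntLeftInv (entComp e M₁ M₂) (entComp ((Equiv.prodComm _ _).trans e) N₂ N₁)
      (canME h) := by
  intro x
  let z := piAmplR (Fin h₁) M₁ fun i => tensorState (x i) (canME h₁)
  refine Eq.trans ?_ (H₁ x)
  rw [entComp_apply]
  congr 1
  funext j
  ext ⟨p, s⟩ ⟨q, s'⟩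
  have slice := congrFun (congrFun (congrFun
    (H₂ fun j => Matrix.of fun u v => z j (u, s) (v, s')) j) p) q
  refine Eq.trans ?_ slice
  simp only [Matrix.of_apply]
  refine congrArg (fun Y => N₂ Y j p q) (funext fun l => ?_)
  ext ⟨u, t⟩ ⟨v, t'⟩
  simp only [piAmplR, Matrix.of_apply, entComp_apply]
  refine congrArg (fun Y => M₂ Y l u v) (funext fun j' => ?_)
  ext ⟨u', r⟩ ⟨v', r'⟩
  simp only [Matrix.of_apply, tensorState_apply, z, piAmplR]
  rw [mul_comm]
  have hscale : (fun i => Matrix.of fun (u₁ v₁ : Fin (a i) × Fin h₁) =>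
      x i u₁.1 v₁.1 * canME h (e (u₁.2, r), (Equiv.prodComm _ _).trans e (t, s))
        (e (v₁.2, r'), (Equiv.prodComm _ _).trans e (t', s'))) =
      canME h₂ (r, t) (r', t') • fun i => Matrix.of fun (u₁ v₁ : Fin (a i) × Fin h₁) =>
        x i u₁.1 v₁.1 * canME h₁ (u₁.2, s) (v₁.2, s') := by
    funext i
    ext u₁ v₁
    simp only [Equiv.trans_apply, Equiv.prodComm_apply, Prod.swap_prod_mk, canME_prod,
      Matrix.of_apply, Pi.smul_apply, Matrix.smul_apply, smul_eq_mul]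
    ring
  rw [hscale, map_smul]
  rfl

/-- A unitary error basis of `M_n(ℂ)`, indexed by `ι`: a family of unitaries containing the
identity and satisfying the completeness relation. -/
structure IsErrorBasis {ι n : Type} [Fintype ι] [Fintype n] [DecidableEq n]
    (U : ι → Mat n) : Prop where
  exists_eq_one : ∃ x, U x = 1
  conjTranspose_mul_self : ∀ x, (U x)ᴴ * U x = 1
  sum_mul_star : ∀ p s p' s',
    ∑ x, U x p s * star (U x p' s') = if p = p' ∧ s = s' then (Fintype.card n : ℂ) else 0

/-- The Weyl operator at `x`: the shift by `x.2` followed by the multiplication by the character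
`p ↦ e(x.1 p)`. -/
def weyl (n : ℕ) [NeZero n] (x : ZMod n × ZMod n) : Mat (ZMod n) :=
  Matrix.of fun p s => if s = p + x.2 then ZMod.stdAddChar (x.1 * p) else 0

theorem star_stdAddChar {n : ℕ} [NeZero n] (x : ZMod n) :
    star (ZMod.stdAddChar x : ℂ) = ZMod.stdAddChar (-x) := by
  rw [AddChar.map_neg_eq_inv]
  exact (Circle.coe_inv_eq_conj (ZMod.toCircle x)).symm.trans (Circle.coe_inv _)

theorem weyl_isErrorBasis (n : ℕ) [NeZero n] : IsErrorBasis (weyl n) := by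
  refine ⟨⟨(0, 0), ?_⟩, fun x => ?_, fun p s p' s' => ?_⟩
  · ext p s
    simp [weyl, Matrix.one_apply, eq_comm]
  · ext s s'
    simp only [weyl, Matrix.mul_apply, Matrix.conjTranspose_apply, Matrix.of_apply,
      Matrix.one_apply]
    rw [Finset.sum_eq_single (s - x.2)]
    · by_cases h : s = s'
      · subst h
        simp [star_stdAddChar, ← AddChar.map_add_eq_mul]
      · simp [h, eq_comm]
    · intro p _ hp
      have : s ≠ p + x.2 := fun h => hp (by simp [h])
      simp [this]
    · simp
  · have hsum := AddChar.sum_mulShift (p - p') (ZMod.isPrimitive_stdAddChar n)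
    simp only [weyl, Matrix.of_apply, Fintype.sum_prod_type]
    have step : ∀ k : ZMod n, ∑ l, (if s = p + l then (ZMod.stdAddChar (k * p) : ℂ) else 0) *
        star (if s' = p' + l then (ZMod.stdAddChar (k * p') : ℂ) else 0) =
        if s - p = s' - p' then ZMod.stdAddChar (k * (p - p')) else 0 := by
      intro k
      rw [Finset.sum_eq_single (s - p)]
      · by_cases h : s - p = s' - p'
        · have h' : s' = p' + (s - p) := by rw [h]; ring
          rw [if_pos (by ring), if_pos h', if_pos h, star_stdAddChar, ← AddChar.map_add_eq_mul]
          congr 1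
          ring
        · have h' : s' ≠ p' + (s - p) := fun e => h (by rw [e]; ring)
          rw [if_neg h', if_neg h, star_zero, mul_zero]
      · intro l _ hl
        have : s ≠ p + l := fun h => hl (by rw [h]; ring)
        simp [this]
      · simp
    simp only [step, Finset.sum_ite_irrel, Finset.sum_const_zero, hsum]
    by_cases hp : p = p'
    · subst hp
      simp
    · simp [hp, sub_eq_zero]

theorem exists_isErrorBasis {n : ℕ} (hn : 1 ≤ n) :
    ∃ U : Fin n × Fin n → Mat (Fin n), IsErrorBasis U := by
  obtain ⟨n, rfl⟩ : ∃ k, n = k + 1 := ⟨n - 1, by omega⟩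
  exact ⟨weyl (n + 1), weyl_isErrorBasis (n + 1)⟩

theorem IsErrorBasis.mul_conjTranspose_self {ι n : Type} [Fintype ι] [Fintype n] [DecidableEq n]
    {U : ι → Mat n} (hU : IsErrorBasis U) (x : ι) : U x * (U x)ᴴ = 1 :=
  mul_eq_one_comm.mp (hU.conjTranspose_mul_self x)

/-- A unitary error basis indexed by pairs is orthogonal for the Hilbert-Schmidt product. -/
theorem IsErrorBasis.sum_star_mul {n : Type} [Fintype n] [DecidableEq n] [Nonempty n]
    {U : n × n → Mat n} (hU : IsErrorBasis U) (x y : n × n) :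
    ∑ p, ∑ s, U x p s * star (U y p s) = if x = y then (Fintype.card n : ℂ) else 0 := by
  have hn : (Fintype.card n : ℂ) ≠ 0 := by exact_mod_cast Fintype.card_ne_zero
  let V : Matrix (n × n) (n × n) ℂ := Matrix.of fun u x => U x u.1 u.2
  have hV : V * ((Fintype.card n : ℂ)⁻¹ • Vᴴ) = 1 := by
    rw [Matrix.mul_smul]
    ext u v
    simp only [Matrix.smul_apply, Matrix.mul_apply, Matrix.conjTranspose_apply,
      V, Matrix.of_apply, hU.sum_mul_star, Matrix.one_apply, smul_eq_mul, mul_ite, mul_zero,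
      inv_mul_cancel₀ hn, Prod.ext_iff]
  have hV' : ((Fintype.card n : ℂ)⁻¹ • Vᴴ) * V = 1 := mul_eq_one_comm.mp hV
  have h := congrFun (congrFun hV' y) x
  rw [Matrix.smul_mul] at h
  simp only [Matrix.smul_apply, Matrix.mul_apply, Matrix.conjTranspose_apply,
    V, Matrix.of_apply, Matrix.one_apply, smul_eq_mul, Fintype.sum_prod_type] at h
  rw [inv_mul_eq_iff_eq_mul₀ hn] at h
  simp only [mul_comm (U x _ _), h, eq_comm, mul_ite, mul_one, mul_zero]

/-- Twirling over a unitary error basis shows that a positive operator is dominated by its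
partial trace. -/
theorem posSemidef_ptraceFst_sub {n : ℕ} {T : Type} [Fintype T] [DecidableEq T]
    {X : Mat (Fin n × T)} (hX : X.PosSemidef) :
    ((n : ℂ) • ((1 : Mat (Fin n)) ⊗ₖ ptraceFst X) - X).PosSemidef := by
  rcases Nat.eq_zero_or_pos n with rfl | hn
  · convert Matrix.PosSemidef.zero
    ext p
    exact p.1.elim0
  obtain ⟨U, hU⟩ := exists_isErrorBasis hn
  obtain ⟨x₀, hx₀⟩ := hU.exists_eq_one
  have key : (n : ℂ) • ((1 : Mat (Fin n)) ⊗ₖ ptraceFst X) =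
      ∑ x, (U x ⊗ₖ (1 : Mat T)) * X * (U x ⊗ₖ (1 : Mat T))ᴴ := by
    ext ⟨p, t⟩ ⟨p', t'⟩
    have expand : ∀ x, ((U x ⊗ₖ (1 : Mat T)) * X * (U x ⊗ₖ (1 : Mat T))ᴴ) (p, t) (p', t') =
        ∑ s', ∑ s, U x p s * star (U x p' s') * X (s, t) (s', t') := by
      intro x
      simp only [Matrix.mul_apply, Fintype.sum_prod_type, Matrix.kroneckerMap_apply,
        Matrix.one_apply, Matrix.conjTranspose_apply, mul_ite, ite_mul, mul_one, mul_zero,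
        zero_mul, Finset.sum_ite_eq, Finset.mem_univ, if_true, apply_ite star, star_zero,
        Finset.sum_mul]
      refine Finset.sum_congr rfl fun s' _ => Finset.sum_congr rfl fun s _ => ?_
      ring
    simp only [Matrix.sum_apply, expand]
    rw [Finset.sum_comm]
    simp only [Finset.sum_comm (s := (Finset.univ : Finset (Fin n × Fin n))), ← Finset.sum_mul,
      hU.sum_mul_star]
    simp [ptraceFst, Matrix.one_apply, ite_and, ite_mul, Finset.sum_ite_irrel, Finset.mul_sum]
  have split := Finset.add_sum_erase Finset.univ
    (fun x => (U x ⊗ₖ (1 : Mat T)) * X * (U x ⊗ₖ (1 : Mat T))ᴴ) (Finset.mem_univ x₀)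
  rw [key, ← split, hx₀]
  simp only [Matrix.one_kronecker_one, Matrix.conjTranspose_one, Matrix.one_mul, Matrix.mul_one,
    add_sub_cancel_left]
  exact Matrix.posSemidef_sum _ fun x _ => hX.mul_mul_conjTranspose_same _

section BlockBasis

variable {m : ℕ} {a : Fin m → ℕ}

/-- The family of elements of `∏ i, M_{a i}(ℂ)` supported in one block and given there by a
member of a family of matrices. -/
def blockBasis (V : (i : Fin m) → Fin (a i) × Fin (a i) → Mat (Fin (a i)))
    (x : (i : Fin m) × (Fin (a i) × Fin (a i))) : (i : Fin m) → Mat (Fin (a i)) :=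
  Pi.single x.1 (V x.1 x.2)

variable {V : (i : Fin m) → Fin (a i) × Fin (a i) → Mat (Fin (a i))}

theorem blockBasis_of_ne {x : (i : Fin m) × (Fin (a i) × Fin (a i))} {i : Fin m}
    (h : x.1 ≠ i) : blockBasis V x i = 0 :=
  Pi.single_eq_of_ne h.symm _

theorem blockBasis_mk (i : Fin m) (y : Fin (a i) × Fin (a i)) :
    blockBasis V ⟨i, y⟩ i = V i y :=
  Pi.single_eq_same _ _

theorem blockBasis_sum_mul_star (hV : ∀ i, IsErrorBasis (V i)) (i : Fin m)
    (p s p' s' : Fin (a i)) :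
    ∑ x, blockBasis V x i p s * star (blockBasis V x i p' s') =
      if p = p' ∧ s = s' then (a i : ℂ) else 0 := by
  rw [Fintype.sum_sigma, Finset.sum_eq_single i]
  · simp only [blockBasis_mk, (hV i).sum_mul_star, Fintype.card_fin]
  · intro j _ hj
    refine Finset.sum_eq_zero fun y _ => ?_
    rw [blockBasis_of_ne (x := ⟨j, y⟩) hj]
    simp
  · simp

theorem blockBasis_conjTranspose_mul_self (hV : ∀ i, IsErrorBasis (V i))
    (x : (i : Fin m) × (Fin (a i) × Fin (a i))) (i : Fin m) :
    (blockBasis V x i)ᴴ * blockBasis V x i = if x.1 = i then 1 else 0 := by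
  split_ifs with h
  · subst h
    rw [show blockBasis V x x.1 = V x.1 x.2 from blockBasis_mk _ _]
    exact (hV _).conjTranspose_mul_self _
  · rw [blockBasis_of_ne h]
    simp

theorem blockBasis_mul_conjTranspose_self (hV : ∀ i, IsErrorBasis (V i))
    (x : (i : Fin m) × (Fin (a i) × Fin (a i))) (i : Fin m) :
    blockBasis V x i * (blockBasis V x i)ᴴ = if x.1 = i then 1 else 0 := by
  split_ifs with h
  · subst h
    rw [show blockBasis V x x.1 = V x.1 x.2 from blockBasis_mk _ _]
    exact (hV _).mul_conjTranspose_self _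
  · rw [blockBasis_of_ne h]
    simp

theorem blockBasis_sum_star_mul (hV : ∀ i, IsErrorBasis (V i))
    (x y : (i : Fin m) × (Fin (a i) × Fin (a i))) (i : Fin m) :
    ∑ p, ∑ s, blockBasis V x i p s * star (blockBasis V y i p s) =
      if x = y ∧ x.1 = i then (a i : ℂ) else 0 := by
  by_cases hx : x.1 = i
  · by_cases hy : y.1 = i
    · obtain ⟨i', x⟩ := x
      obtain ⟨j', y⟩ := y
      dsimp only at hx hy
      subst hx
      subst hy
      have : Nonempty (Fin (a j')) := ⟨x.1⟩
      simp only [blockBasis_mk, (hV j').sum_star_mul, Fintype.card_fin, Sigma.mk.injEq, heq_eq_eq,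
        true_and, and_true]
    · have hxy : x ≠ y := fun h => hy (h ▸ hx)
      simp [blockBasis_of_ne hy, hxy]
  · simp [blockBasis_of_ne hx, hx]

end BlockBasis

section Teleportation

variable {m d h : ℕ} {a r : Fin m → ℕ}

/-- The Kraus operator of a member of the block basis, acting on `Fin h ≃ Fin (a i) × Fin (r i)`
and projecting the second factor onto a basis vector. -/
def blockKraus (V : (i : Fin m) → Fin (a i) × Fin (a i) → Mat (Fin (a i)))
    (f : Fin d ≃ (i : Fin m) × (Fin (a i) × Fin (a i)))
    (e : (i : Fin m) → Fin h ≃ Fin (a i) × Fin (r i)) (i : Fin m) (x : Fin d) (k : Fin (r i)) :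
    Matrix (Fin (a i)) (Fin h) ℂ :=
  Matrix.of fun p t => if (e i t).2 = k then blockBasis V (f x) i p (e i t).1 else 0

variable {V : (i : Fin m) → Fin (a i) × Fin (a i) → Mat (Fin (a i))}
  {f : Fin d ≃ (i : Fin m) × (Fin (a i) × Fin (a i))}
  {e : (i : Fin m) → Fin h ≃ Fin (a i) × Fin (r i)}

theorem blockKraus_of_ne {i : Fin m} {x : Fin d} (hx : (f x).1 ≠ i) (k : Fin (r i)) :
    blockKraus V f e i x k = 0 := by
  ext p t
  simp [blockKraus, blockBasis_of_ne hx]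

theorem blockKraus_sum_mul_star (hV : ∀ i, IsErrorBasis (V i)) (i : Fin m)
    (p p' : Fin (a i)) (t t' : Fin h) :
    ∑ x, ∑ k, blockKraus V f e i x k p t * star (blockKraus V f e i x k p' t') =
      if p = p' ∧ t = t' then (a i : ℂ) else 0 := by
  have hinner : ∀ x, ∑ k, blockKraus V f e i x k p t * star (blockKraus V f e i x k p' t') =
      if (e i t).2 = (e i t').2 then
        blockBasis V (f x) i p (e i t).1 * star (blockBasis V (f x) i p' (e i t').1) else 0 := by
    intro x
    simp [blockKraus, apply_ite star, eq_comm]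
  simp only [hinner, Finset.sum_ite_irrel, Finset.sum_const_zero]
  rw [Equiv.sum_comp f (fun x => blockBasis V x i p (e i t).1 *
    star (blockBasis V x i p' (e i t').1)), blockBasis_sum_mul_star hV]
  have : t = t' ↔ (e i t).1 = (e i t').1 ∧ (e i t).2 = (e i t').2 := by
    rw [← Prod.ext_iff, (e i).injective.eq_iff]
  simp only [this]
  split_ifs <;> simp_all

theorem blockKraus_sum_conjTranspose_mul_self (hV : ∀ i, IsErrorBasis (V i)) (x : Fin d) :
    ∑ i, ∑ k, (blockKraus V f e i x k)ᴴ * blockKraus V f e i x k = 1 := by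
  rw [Finset.sum_eq_single (f x).1]
  · ext t t'
    have hU := congrFun (congrFun (blockBasis_conjTranspose_mul_self hV (f x) (f x).1)
      (e _ t).1) (e _ t').1
    simp only [Matrix.mul_apply, Matrix.conjTranspose_apply, if_true, Matrix.one_apply] at hU
    have ht : t = t' ↔ (e (f x).1 t).1 = (e (f x).1 t').1 ∧
        (e (f x).1 t).2 = (e (f x).1 t').2 := by
      rw [← Prod.ext_iff, (e _).injective.eq_iff]
    simp only [Matrix.sum_apply, Matrix.mul_apply, Matrix.conjTranspose_apply, Matrix.one_apply]
    rw [Finset.sum_comm]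
    have hinner : ∀ p, ∑ k, star (blockKraus V f e (f x).1 x k p t) *
        blockKraus V f e (f x).1 x k p t' =
        if (e (f x).1 t).2 = (e (f x).1 t').2 then
          star (blockBasis V (f x) (f x).1 p (e _ t).1) *
            blockBasis V (f x) (f x).1 p (e _ t').1 else 0 := by
      intro p
      simp [blockKraus, apply_ite star, eq_comm]
    simp only [hinner, Finset.sum_ite_irrel, Finset.sum_const_zero, hU, ht]
    split_ifs <;> simp_all
  · intro i _ hi
    simp [blockKraus_of_ne hi.symm]
  · simp

theorem blockKraus_sum_star_mul (hV : ∀ i, IsErrorBasis (V i)) (i : Fin m) (x : Fin d)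
    (k l : Fin (r i)) (p p' : Fin (a i)) :
    ∑ t, star (blockKraus V f e i x l p t) * blockKraus V f e i x k p' t =
      if p = p' then (if k = l ∧ (f x).1 = i then 1 else 0) else 0 := by
  have hU := congrFun (congrFun (blockBasis_mul_conjTranspose_self hV (f x) i) p') p
  simp only [Matrix.mul_apply, Matrix.conjTranspose_apply] at hU
  rw [← Equiv.sum_comp (e i).symm, Fintype.sum_prod_type]
  simp only [blockKraus, Matrix.of_apply, Equiv.apply_symm_apply, apply_ite star, star_zero,
    mul_ite, ite_mul, zero_mul, mul_zero, Finset.sum_ite_eq', Finset.mem_univ, if_true]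
  simp only [mul_comm (star _), Finset.sum_ite_irrel, Finset.sum_const_zero, hU]
  by_cases hx : (f x).1 = i <;> by_cases hk : k = l <;> simp [hx, hk, Matrix.one_apply, eq_comm]

theorem blockKraus_sum_sum_mul_star (hV : ∀ i, IsErrorBasis (V i)) (i : Fin m) (x y : Fin d)
    (k l : Fin (r i)) :
    ∑ p, ∑ t, blockKraus V f e i x k p t * star (blockKraus V f e i y l p t) =
      if x = y ∧ k = l ∧ (f x).1 = i then (a i : ℂ) else 0 := by
  have hU := blockBasis_sum_star_mul hV (f x) (f y) i
  have hinner : ∀ p, ∑ t, blockKraus V f e i x k p t * star (blockKraus V f e i y l p t) =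
      if k = l then ∑ s, blockBasis V (f x) i p s * star (blockBasis V (f y) i p s) else 0 := by
    intro p
    rw [← Equiv.sum_comp (e i).symm, Fintype.sum_prod_type]
    simp only [blockKraus, Matrix.of_apply, Equiv.apply_symm_apply, apply_ite star, star_zero,
      mul_ite, ite_mul, zero_mul, mul_zero, Finset.sum_ite_eq', Finset.mem_univ, if_true]
    simp only [Finset.sum_ite_irrel, Finset.sum_const_zero, eq_comm]
  simp only [hinner, Finset.sum_ite_irrel, Finset.sum_const_zero, hU,
    EmbeddingLike.apply_eq_iff_eq, ← ite_and]
  exact if_congr (by tauto) rfl rfl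

end Teleportation

/-- Teleportation and dense coding: a multimatrix algebra of dimension `d` and the commutative
algebra `ℂ^d` are related by a pair of mutually entanglement-inverse channels. -/
theorem exists_teleportation {m d : ℕ} (a : Fin m → ℕ) (ha : ∀ i, 1 ≤ a i)
    (hd : ∑ i, a i ^ 2 = d) :
    ∃ h : ℕ, 1 ≤ h ∧
      ∃ (P : ((i : Fin m) → Mat (Fin (a i) × Fin h)) →ₗ[ℂ]
          (Fin d → Mat (Fin 1)))
        (Q : (Fin d → Mat (Fin 1 × Fin h)) →ₗ[ℂ] (i : Fin m) → Mat (Fin (a i))),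
        PiIsChannel P ∧ PiIsChannel Q ∧
        PiEntLeftInv (b := fun _ => 1) P Q (canME h) ∧
        PiEntLeftInv (a := fun _ => 1) Q P (canME h) := by
  choose V hV using fun i => exists_isErrorBasis (ha i)
  let h := ∏ i, a i
  have hpos : 1 ≤ h := Nat.succ_le_of_lt (Finset.prod_pos fun i _ => ha i)
  choose r hr using fun i => Finset.dvd_prod_of_mem a (Finset.mem_univ i)
  let e (i : Fin m) : Fin h ≃ Fin (a i) × Fin (r i) :=
    (finCongr (hr i)).trans finProdFinEquiv.symm
  have hcard : Fintype.card (Fin d) =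
      Fintype.card ((i : Fin m) × (Fin (a i) × Fin (a i))) := by
    simp [← hd, sq]
  let f := Fintype.equivOfCardEq hcard
  have ha0 : ∀ i, (a i : ℂ) ≠ 0 := fun i => by
    exact_mod_cast Nat.one_le_iff_ne_zero.mp (ha i)
  let c (i : Fin m) : ℂ := ((Real.sqrt (a i) : ℝ) : ℂ)⁻¹
  have hstar : ∀ i, star (c i) = c i := fun i => by simp [c]
  have hc : ∀ i, c i * c i = (a i : ℂ)⁻¹ := fun i => by
    rw [← mul_inv, ← Complex.ofReal_mul, Real.mul_self_sqrt (Nat.cast_nonneg _),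
      Complex.ofReal_natCast]
  let K (i : Fin m) (x : Fin d) (k : Fin (r i)) :
      Matrix (Fin 1) (Fin (a i) × Fin h) ℂ :=
    Matrix.of fun _ u => c i * blockKraus V f e i x k u.1 u.2
  let L (x : Fin d) (i : Fin m) (k : Fin (r i)) :
      Matrix (Fin (a i)) (Fin 1 × Fin h) ℂ :=
    Matrix.of fun p u => star (blockKraus V f e i x k p u.2)
  have har : ∀ i, (a i : ℂ) * r i = h := fun i => by exact_mod_cast (hr i).symm
  refine ⟨h, hpos, krausMap K, krausMap L, krausMap_isChannel K fun i => ?_,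
    krausMap_isChannel L fun x => ?_,
    krausMap_entLeftInv (b := fun _ => 1) K L
      (fun i x k l => c i * if k = l ∧ (f x).1 = i then 1 else 0)
      (fun i x k l p p' => ?_) (fun i i' x k l p p' hi => ?_) (fun i => ?_) (by omega),
    krausMap_entLeftInv (a := fun _ => 1) L K
      (fun x i k l => c i * if k = l ∧ (f x).1 = i then (a i : ℂ) else 0)
      (fun x i k l p p' => ?_) (fun x y i k l p p' hxy => ?_) (fun x => ?_) (by omega)⟩
  · ext ⟨p, t⟩ ⟨p', t'⟩
    have := congrArg (fun z => (a i : ℂ)⁻¹ * z)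
      (blockKraus_sum_mul_star (f := f) (e := e) hV i p' p t' t)
    simp only [Finset.mul_sum, mul_ite, mul_zero, inv_mul_cancel₀ (ha0 i)] at this
    simp only [Matrix.sum_apply, Matrix.mul_apply, Matrix.conjTranspose_apply, K, Matrix.of_apply,
      Finset.univ_unique, Finset.sum_singleton, star_mul', hstar, Matrix.one_apply,
      Prod.mk.injEq]
    refine Eq.trans ?_ (this.trans (if_congr (and_congr eq_comm eq_comm) rfl rfl))
    refine Finset.sum_congr rfl fun x _ => Finset.sum_congr rfl fun k _ => ?_
    rw [← hc]
    ring
  · ext ⟨o, t⟩ ⟨o', t'⟩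
    have := congrFun (congrFun
      (blockKraus_sum_conjTranspose_mul_self (f := f) (e := e) hV x) t') t
    simp only [Matrix.sum_apply, Matrix.mul_apply, Matrix.conjTranspose_apply,
      Matrix.one_apply] at this
    simp only [Matrix.sum_apply, Matrix.mul_apply, Matrix.conjTranspose_apply, L, Matrix.of_apply,
      star_star, Matrix.one_apply, Prod.mk.injEq, Subsingleton.elim o o', true_and]
    simp only [mul_comm (blockKraus V f e _ _ _ _ _), this, eq_comm]
  · have := blockKraus_sum_star_mul (f := f) (e := e) hV i x k l p p'
    simp only [Finset.univ_unique, Finset.sum_singleton, K, L, Matrix.of_apply]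
    simp only [mul_left_comm _ (c i), ← Finset.mul_sum, this]
    split_ifs <;> simp
  · by_cases hx : (f x).1 = i
    · have hx' : (f x).1 ≠ i' := fun h' => hi (hx ▸ h')
      simp [K, L, blockKraus_of_ne hx']
    · simp [K, L, blockKraus_of_ne hx]
  · have hcount : ∑ x, (if (f x).1 = i then (1 : ℂ) else 0) = (a i : ℂ) * a i := by
      rw [Equiv.sum_comp f (fun x => if x.1 = i then (1 : ℂ) else 0), Fintype.sum_sigma,
        Finset.sum_eq_single i]
      · simp
      · intro j _ hj
        simp [hj]
      · simp
    calc _ = ∑ x, (if (f x).1 = i then (1 : ℂ) else 0) * ((a i : ℂ)⁻¹ * r i) := by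
          refine Finset.sum_congr rfl fun x _ => ?_
          by_cases hx : (f x).1 = i <;> simp [hx, hstar, hc, apply_ite star, mul_comm]
      _ = h := by
          rw [← Finset.sum_mul, hcount, ← har i]
          field_simp [ha0 i]
  · have := blockKraus_sum_sum_mul_star (f := f) (e := e) hV i x x l k
    simp only [K, L, Matrix.of_apply, mul_assoc, ← Finset.mul_sum, this, Subsingleton.elim p p']
    simp [eq_comm]
  · have := blockKraus_sum_sum_mul_star (f := f) (e := e) hV i x y l k
    simp only [K, L, Matrix.of_apply, mul_assoc, ← Finset.mul_sum, this, hxy]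
    simp
  · rw [Finset.sum_eq_single (f x).1]
    · have : ∀ k l : Fin (r (f x).1), (c (f x).1 * if k = l ∧ (f x).1 = (f x).1 then
          (a (f x).1 : ℂ) else 0) * star (c (f x).1 * if k = l ∧ (f x).1 = (f x).1 then
          (a (f x).1 : ℂ) else 0) = if k = l then (a (f x).1 : ℂ) else 0 := by
        intro k l
        split_ifs with h1 h2 h2
        · rw [star_mul', hstar, star_natCast, mul_mul_mul_comm, hc]
          field_simp [ha0 (f x).1]
        · exact absurd h1.1 h2
        · exact absurd ⟨h2, rfl⟩ h1
        · simp
      rw [Finset.sum_congr rfl fun k _ => Finset.sum_congr rfl fun l _ => this k l]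
      simp only [Finset.sum_ite_eq, Finset.mem_univ, if_true, Finset.sum_const,
        Finset.card_univ, Fintype.card_fin, nsmul_eq_mul]
      rw [mul_comm, har]
    · intro i _ hi
      simp [hi.symm]
    · simp

theorem ptraceFst_posSemidef {p t : Type} [Fintype p] {X : Mat (p × t)} (hX : X.PosSemidef) :
    (ptraceFst X).PosSemidef := by
  have : ptraceFst X = ∑ u, X.submatrix (Prod.mk u) (Prod.mk u) := by
    ext s s'
    simp [ptraceFst, Matrix.sum_apply]
  rw [this]
  exact Matrix.posSemidef_sum _ fun u _ => hX.submatrix _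

/-- The dense coding bound: at most `dim B` classical messages can be sent through `B` with the
assistance of a maximally entangled state. -/
theorem PiEntLeftInv.classical_le {d n h : ℕ} {b : Fin n → ℕ} (hh : 1 ≤ h)
    {M : (Fin d → Mat (Fin 1 × Fin h)) →ₗ[ℂ] (j : Fin n) → Mat (Fin (b j))}
    {N : ((j : Fin n) → Mat (Fin (b j) × Fin h)) →ₗ[ℂ] (Fin d → Mat (Fin 1))}
    (hM : PiIsChannel M) (hN : PiIsChannel N)
    (H : PiEntLeftInv (a := fun _ => 1) M N (canME h)) : d ≤ ∑ j, b j ^ 2 := by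
  have hh0 : (h : ℂ) ≠ 0 := by exact_mod_cast (by omega : h ≠ 0)
  let σ (x : Fin d) : (j : Fin n) → Mat (Fin (b j) × Fin h) :=
    piAmplR (Fin h) M fun i => tensorState ((Pi.single x 1 : Fin d → Mat (Fin 1)) i) (canME h)
  have hσ : ∀ x j, (σ x j).PosSemidef := fun x j =>
    hM.1.piAmplR_posSemidef (fun i => by
      refine Matrix.PosSemidef.submatrix (Matrix.PosSemidef.kronecker ?_ ?_) _
      · by_cases hi : i = x
        · subst hi
          rw [Pi.single_eq_same]
          exact Matrix.PosSemidef.one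
        · rw [Pi.single_eq_of_ne hi]
          exact Matrix.PosSemidef.zero
      · exact Matrix.posSemidef_vecMulVec_self_star _) j
  have hmarginal : ∀ x, ∑ j, ptraceFst (σ x j) = (h : ℂ)⁻¹ • (1 : Mat (Fin h)) := by
    intro x
    ext t t'
    have := hM.2 (fun i => Matrix.of fun u v =>
      tensorState ((Pi.single x 1 : Fin d → Mat (Fin 1)) i) (canME h) (u, t) (v, t'))
    rw [Matrix.sum_apply]
    refine Eq.trans this ?_
    simp only [Matrix.trace, Matrix.diag_apply, Matrix.of_apply, tensorState_apply,
      Fintype.sum_prod_type, canME_apply, Finset.univ_unique, Finset.sum_singleton]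
    rw [Finset.sum_eq_single x]
    · simp [Matrix.one_apply, ite_and]
    · intro i _ hi
      simp [Pi.single_eq_of_ne hi]
    · simp
  let D (j : Fin n) : Mat (Fin (b j) × Fin h) := ((b j : ℂ) * (h : ℂ)⁻¹) • 1
  have hD : ∀ x j, ((D - σ x) j).PosSemidef := by
    intro x j
    have hsplit : (D - σ x) j =
        ((b j : ℂ) • ((1 : Mat (Fin (b j))) ⊗ₖ ptraceFst (σ x j)) - σ x j) +
        (b j : ℂ) • ((1 : Mat (Fin (b j))) ⊗ₖ
          ∑ j' ∈ Finset.univ.erase j, ptraceFst (σ x j')) := by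
      have hj := Finset.add_sum_erase Finset.univ (fun j' => ptraceFst (σ x j'))
        (Finset.mem_univ j)
      rw [hmarginal] at hj
      rw [sub_add_eq_add_sub, ← smul_add, ← Matrix.kronecker_add, hj, Pi.sub_apply]
      simp [D, Matrix.kronecker_smul, smul_smul]
    rw [hsplit]
    refine (posSemidef_ptraceFst_sub (hσ x j)).add (Matrix.PosSemidef.smul
      (Matrix.PosSemidef.kronecker Matrix.PosSemidef.one ?_) (Nat.cast_nonneg _))
    exact Matrix.posSemidef_sum _ fun j' _ => ptraceFst_posSemidef (hσ x j')
  have hle : ∀ x, (1 : ℂ) ≤ (N D x).trace := by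
    intro x
    have hpos := (hN.1.apply_posSemidef (hD x) x).trace_nonneg
    have hx : N (σ x) = Pi.single x 1 := H (Pi.single x 1)
    rw [map_sub, hx, Pi.sub_apply, Pi.single_eq_same, Matrix.trace_sub, sub_nonneg] at hpos
    simpa using hpos
  have htotal : ∑ x, (N D x).trace = ∑ j, (b j : ℂ) ^ 2 := by
    rw [hN.2]
    refine Finset.sum_congr rfl fun j _ => ?_
    simp only [D, Matrix.trace_smul, Matrix.trace_one, Fintype.card_prod, Fintype.card_fin,
      smul_eq_mul, Nat.cast_mul]
    field_simp
  have hfinal : (d : ℂ) ≤ ∑ j, (b j : ℂ) ^ 2 := by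
    rw [← htotal]
    simpa using Finset.sum_le_sum fun x (_ : x ∈ Finset.univ) => hle x
  exact_mod_cast hfinal

/-- An entanglement-reversible channel cannot decrease the dimension. -/
theorem PiEntLeftInv.dim_le {m n h : ℕ} {a : Fin m → ℕ} {b : Fin n → ℕ} (ha : ∀ i, 1 ≤ a i)
    (hh : 1 ≤ h)
    {M : ((i : Fin m) → Mat (Fin (a i) × Fin h)) →ₗ[ℂ] (j : Fin n) → Mat (Fin (b j))}
    {N : ((j : Fin n) → Mat (Fin (b j) × Fin h)) →ₗ[ℂ] (i : Fin m) → Mat (Fin (a i))}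
    (hM : PiIsChannel M) (hN : PiIsChannel N) (H : PiEntLeftInv M N (canME h)) :
    ∑ i, a i ^ 2 ≤ ∑ j, b j ^ 2 := by
  obtain ⟨h', hh', P, Q, hP, hQ, -, hQP⟩ := exists_teleportation a ha rfl
  exact PiEntLeftInv.classical_le (Nat.mul_pos hh' hh)
    (PiIsChannel.entComp (a := fun _ => 1) finProdFinEquiv hQ hM)
    (PiIsChannel.entComp (b := fun _ => 1) _ hN hP)
    (PiEntLeftInv.entComp (a := fun _ => 1) finProdFinEquiv hQP H)

/-- **Existence of entanglement-invertible channels between multimatrix algebras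
of equal dimension.** There is a channel `A ⊗ M_h(ℂ) → B` entanglement-invertible
with respect to the canonical maximally entangled state, for some `h ≥ 1`, iff
`dim A = dim B`. -/
theorem exists_entanglement_invertible_iff_dim_eq
    {m n : ℕ} (a : Fin m → ℕ) (b : Fin n → ℕ)
    (ha : ∀ i, 1 ≤ a i) (hb : ∀ j, 1 ≤ b j) :
    (∃ h : ℕ, 1 ≤ h ∧
      ∃ M : ((i : Fin m) → Mat (Fin (a i) × Fin h)) →ₗ[ℂ] (j : Fin n) → Mat (Fin (b j)),
        PiIsChannel M ∧ PiEntInvertible M (canME h)) ↔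
    ∑ i, (a i) ^ 2 = ∑ j, (b j) ^ 2 := by
  constructor
  · rintro ⟨h, hh, M, hM, N, hN, hleft, hright⟩
    exact le_antisymm (hleft.dim_le ha hh hM hN)
      ((piEntRightInv_canME_iff.mp hright).dim_le hb hh hN hM)
  · intro hdim
    obtain ⟨h₁, hh₁, P, Q, hP, hQ, hPQ, hQP⟩ := exists_teleportation a ha hdim
    obtain ⟨h₂, hh₂, P', Q', hP', hQ', hPQ', hQP'⟩ := exists_teleportation b hb rfl
    let e : Fin h₁ × Fin h₂ ≃ Fin (h₁ * h₂) := finProdFinEquiv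
    exact ⟨h₁ * h₂, Nat.mul_pos hh₁ hh₂, entComp (c := fun _ => 1) e P Q',
      PiIsChannel.entComp (c := fun _ => 1) e hP hQ',
      entComp (c := fun _ => 1) ((Equiv.prodComm _ _).trans e) P' Q,
      PiIsChannel.entComp (c := fun _ => 1) _ hP' hQ,
      PiEntLeftInv.entComp (c := fun _ => 1) e hPQ hQP',
      piEntRightInv_canME_iff.mpr
        (PiEntLeftInv.entComp (c := fun _ => 1) ((Equiv.prodComm _ _).trans e) hPQ' hQP)⟩

end EntInvPaper
end
end
end
end

section
/- Reduction of entanglement-reversibility to the case of an invertible pure resource state. Let A and B be multimatrix algebras, let h₁, h₂ ≥ 1, and let ω : ℂ^{h₁} → ℂ^{h₂} be a nonzero linear map with Tr(ω†ω) = 1; let r be the rank of ω. Choose an isometry j : ℂ^r → ℂ^{h₂} whose range is the range of ω and a coisometry q : ℂ^{h₁} → ℂ^r (q q† = I_r) such that q†q is the orthogonal projection onto the orthogonal complement of ker ω; then ω̄ := j†·ω·q† ∈ M_r(ℂ) is invertible, Tr(ω̄†ω̄) = 1, and ω = j·ω̄·q. Let W_ω and W_{ω̄} be the pure states defined by ω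 and ω̄ respectively, and given a channel M : A⊗M_{h₁}(ℂ) → B define the channel M̄ : A⊗M_r(ℂ) → B by M̄(x⊗σ) := M(x ⊗ qᵀ σ (qᵀ)†), where qᵀ is the transpose of q in the standard bases (an isometry ℂ^r → ℂ^{h₁}). Then M is entanglement-reversible with respect to W_ω if and only if M̄ is entanglement-reversible with respect to W_{ω̄}; and M is entanglement-invertible with respect to W_ω if and only if M̄ is entanglement-invertible with respect to W_{ω̄}. -/
noncomputable section

open Matrix Kronecker
open scoped ComplexOrder

noncomputable section

open Matrix Kronecker
open scoped ComplexOrder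

noncomputable section
open Matrix Kronecker
open scoped ComplexOrder
namespace EntInvPaper

variable {ι κ : Type} {A : ι → Type} {B : κ → Type} {t τ : Type}

/-- Conjugation of the second tensor factor by `K`, on a multimatrix algebra tensored with `M_t`. -/
def conjSnd [∀ i, Fintype (A i)] [∀ i, DecidableEq (A i)] [Fintype t] (K : Matrix τ t ℂ) :
    ((i : ι) → Mat (A i × t)) →ₗ[ℂ] (i : ι) → Mat (A i × τ) :=
  LinearMap.pi fun i => conjBy ((1 : Mat (A i)) ⊗ₖ K) ∘ₗ LinearMap.proj i

section

variable [∀ i, Fintype (A i)] [∀ i, DecidableEq (A i)] [Fintype t]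

lemma conjSnd_apply (K : Matrix τ t ℂ) (X : (i : ι) → Mat (A i × t)) (i : ι) :
    conjSnd K X i = ((1 : Mat (A i)) ⊗ₖ K) * X i * ((1 : Mat (A i)) ⊗ₖ K)ᴴ := rfl

lemma conjSnd_apply_apply (K : Matrix τ t ℂ) (X : (i : ι) → Mat (A i × t)) (i : ι)
    (p q : A i × τ) :
    conjSnd K X i p q = ∑ u, ∑ v, K p.2 u * star (K q.2 v) * X i (p.1, u) (q.1, v) := by
  simp only [conjSnd_apply, Matrix.mul_apply, conjTranspose_apply, kroneckerMap_apply,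
    Fintype.sum_prod_type, Matrix.one_apply, ite_mul, one_mul, zero_mul, Finset.sum_ite_irrel,
    Finset.sum_const_zero, Finset.sum_ite_eq, Finset.mem_univ, if_true]
  rw [Finset.sum_eq_single q.1]
  · simp only [if_true, Finset.sum_mul]
    rw [Finset.sum_comm]
    exact Finset.sum_congr rfl fun u _ => Finset.sum_congr rfl fun v _ => by ring
  · intro c _ hc
    simp [Ne.symm hc]
  · simp

/-- Amplifications commute with conjugations of the auxiliary factor. -/
lemma piAmplR_conjSnd [∀ j, Fintype (B j)] [∀ j, DecidableEq (B j)]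
    (Φ : ((i : ι) → Mat (A i)) →ₗ[ℂ] (j : κ) → Mat (B j)) (K : Matrix τ t ℂ)
    (X : (i : ι) → Mat (A i × t)) :
    piAmplR τ Φ (conjSnd K X) = conjSnd K (piAmplR t Φ X) := by
  funext j
  ext p q
  have h : (fun i => Matrix.of fun x y => conjSnd K X i (x, p.2) (y, q.2)) =
      ∑ u, ∑ v, (K p.2 u * star (K q.2 v)) •
        fun i => (Matrix.of fun x y => X i (x, u) (y, v) : Mat (A i)) := by
    funext i
    ext x y
    simp [conjSnd_apply_apply, Finset.sum_apply, Matrix.sum_apply]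
  rw [conjSnd_apply_apply]
  simp only [piAmplR, Matrix.of_apply]
  rw [h]
  simp [Finset.sum_apply, Matrix.sum_apply]

end

/-- Pushing both factors of `ω = J η Q` out of the resource state: the left factor acts after the
amplified map, the right one before it. -/
lemma piAmplR_tensorState_pureState [∀ i, Fintype (A i)] [∀ i, DecidableEq (A i)]
    [∀ j, Fintype (B j)] [∀ j, DecidableEq (B j)] {h₁ h₂ r s : Type} [Fintype h₁]
    [DecidableEq h₁] [Fintype r] [Fintype s]
    (Φ : ((i : ι) → Mat (A i × h₁)) →ₗ[ℂ] (j : κ) → Mat (B j))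
    (J : Matrix h₂ r ℂ) (η : Matrix r s ℂ) (Q : Matrix s h₁ ℂ) (x : (i : ι) → Mat (A i)) :
    piAmplR h₂ Φ (fun i => tensorState (x i) (pureState (J * η * Q))) =
      conjSnd J (piAmplR r (Φ ∘ₗ conjSnd Qᵀ) fun i => tensorState (x i) (pureState η)) := by
  have hJ : (fun i => tensorState (x i) (pureState (J * η * Q))) =
      conjSnd J fun i => tensorState (x i) (pureState (η * Q)) := by
    funext i
    ext p q
    simp only [conjSnd_apply_apply, tensorState, pureState, outer, pureVec, reindex_apply,
      submatrix_apply, kroneckerMap_apply, vecMulVec_apply, Equiv.symm_symm, Equiv.prodAssoc_apply,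
      Pi.star_apply, Matrix.mul_assoc]
    rw [Matrix.mul_apply, Matrix.mul_apply, star_sum, Finset.sum_mul_sum, Finset.mul_sum]
    refine Finset.sum_congr rfl fun u _ => ?_
    rw [Finset.mul_sum]
    refine Finset.sum_congr rfl fun v _ => ?_
    rw [star_mul']
    ring
  have hQ : piAmplR r Φ (fun i => tensorState (x i) (pureState (η * Q))) =
      piAmplR r (Φ ∘ₗ conjSnd Qᵀ) fun i => tensorState (x i) (pureState η) := by
    funext j
    ext p q
    simp only [piAmplR, Matrix.of_apply, LinearMap.comp_apply]
    refine congrArg (fun Z => Φ Z j p.1 q.1) (funext fun i => ?_)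
    ext k l
    simp only [conjSnd_apply_apply, tensorState, pureState, outer, pureVec, reindex_apply,
      submatrix_apply, kroneckerMap_apply, vecMulVec_apply, Equiv.symm_symm, Equiv.prodAssoc_apply,
      Pi.star_apply, Matrix.of_apply, transpose_apply]
    rw [Matrix.mul_apply, Matrix.mul_apply, star_sum, Finset.sum_mul_sum, Finset.mul_sum]
    refine Finset.sum_congr rfl fun u _ => ?_
    rw [Finset.mul_sum]
    refine Finset.sum_congr rfl fun v _ => ?_
    rw [star_mul']
    ring
  rw [hJ, piAmplR_conjSnd, hQ]

lemma swapState_pureState {h₁ h₂ : Type} (ω : Matrix h₂ h₁ ℂ) :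
    swapState (pureState ω) = pureState ωᵀ := rfl

section

variable {m n h₁ h₂ r s : ℕ} {a : Fin m → ℕ} {b : Fin n → ℕ}
    (M : ((i : Fin m) → Mat (Fin (a i) × Fin h₁)) →ₗ[ℂ] (j : Fin n) → Mat (Fin (b j)))
    (N : ((j : Fin n) → Mat (Fin (b j) × Fin h₂)) →ₗ[ℂ] (i : Fin m) → Mat (Fin (a i)))
    (J : Matrix (Fin h₂) (Fin r) ℂ) (η : Matrix (Fin r) (Fin s) ℂ)
    (Q : Matrix (Fin s) (Fin h₁) ℂ)

lemma piEntLeftInv_mul_mul_iff :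
    PiEntLeftInv M N (pureState (J * η * Q)) ↔
      PiEntLeftInv (M ∘ₗ conjSnd Qᵀ) (N ∘ₗ conjSnd J) (pureState η) := by
  simp only [PiEntLeftInv, piAmplR_tensorState_pureState, LinearMap.comp_apply]

lemma piEntRightInv_mul_mul_iff :
    PiEntRightInv M N (pureState (J * η * Q)) ↔
      PiEntRightInv (M ∘ₗ conjSnd Qᵀ) (N ∘ₗ conjSnd J) (pureState η) := by
  simp only [PiEntRightInv, swapState_pureState, transpose_mul, ← Matrix.mul_assoc,
    piAmplR_tensorState_pureState, LinearMap.comp_apply, transpose_transpose]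

end

/-- Precomposing a channel with a Kraus-form channel on the second tensor factor gives a channel. -/
lemma PiIsChannel.comp_sum_conjSnd [Fintype ι] [Fintype κ] [∀ i, Fintype (A i)]
    [∀ i, DecidableEq (A i)] [∀ j, Fintype (B j)] [Fintype t] [DecidableEq t] [Fintype τ]
    {Φ : ((i : ι) → Mat (A i × τ)) →ₗ[ℂ] (j : κ) → Mat (B j)} (hΦ : PiIsChannel Φ)
    {ε : Type} [Fintype ε] (K : ε → Matrix τ t ℂ) (hK : ∑ e, (K e)ᴴ * K e = 1) :
    PiIsChannel (Φ ∘ₗ ∑ e, conjSnd (K e)) := by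
  refine ⟨fun k X hX j => ?_, fun X => ?_⟩
  · have h : piAmplL (Fin k) (Φ ∘ₗ ∑ e, conjSnd (K e)) X =
        piAmplL (Fin k) Φ fun i => ∑ e, ((1 : Mat (Fin k)) ⊗ₖ ((1 : Mat (A i)) ⊗ₖ K e)) * X i *
          ((1 : Mat (Fin k)) ⊗ₖ ((1 : Mat (A i)) ⊗ₖ K e))ᴴ := by
      funext j
      ext p q
      simp only [piAmplL, Matrix.of_apply, LinearMap.comp_apply]
      refine congrArg (fun Z => Φ Z j p.2 q.2) (funext fun i => ?_)
      ext x y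
      simp only [LinearMap.sum_apply, Finset.sum_apply, Matrix.sum_apply, Matrix.of_apply]
      refine Finset.sum_congr rfl fun e _ => ?_
      refine Eq.trans ?_ (conjSnd_apply_apply (A := fun _ : Unit => Fin k)
        ((1 : Mat (A i)) ⊗ₖ K e) (fun _ => X i) () (p.1, x) (q.1, y)).symm
      simp only [conjSnd_apply, Matrix.mul_apply, conjTranspose_apply, Finset.sum_mul,
        Matrix.of_apply]
      rw [Finset.sum_comm]
      exact Finset.sum_congr rfl fun u _ => Finset.sum_congr rfl fun v _ => by ring
    rw [h]
    exact hΦ.1 k _ (fun i => posSemidef_sum _ fun e _ => (hX i).mul_mul_conjTranspose_same _) j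
  · rw [LinearMap.comp_apply, hΦ.2]
    refine Finset.sum_congr rfl fun i _ => ?_
    have h : ∑ e, ((1 : Mat (A i)) ⊗ₖ K e)ᴴ * ((1 : Mat (A i)) ⊗ₖ K e) = 1 := by
      rw [← one_kronecker_one, ← hK]
      ext p q
      simp [conjTranspose_kronecker, ← mul_kronecker_mul, Matrix.sum_apply, Finset.mul_sum]
    calc (((∑ e, conjSnd (K e)) X) i).trace
        = ∑ e, (((1 : Mat (A i)) ⊗ₖ K e)ᴴ * ((1 : Mat (A i)) ⊗ₖ K e) * X i).trace := by
          simp only [LinearMap.sum_apply, Finset.sum_apply, trace_sum, conjSnd_apply]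
          exact Finset.sum_congr rfl fun e _ => trace_mul_cycle _ _ _
      _ = (X i).trace := by rw [← trace_sum, ← Matrix.sum_mul, h, one_mul]

lemma PiIsChannel.comp_conjSnd [Fintype ι] [Fintype κ] [∀ i, Fintype (A i)]
    [∀ i, DecidableEq (A i)] [∀ j, Fintype (B j)] [Fintype t] [DecidableEq t] [Fintype τ]
    {Φ : ((i : ι) → Mat (A i × τ)) →ₗ[ℂ] (j : κ) → Mat (B j)} (hΦ : PiIsChannel Φ)
    {J : Matrix τ t ℂ} (hJ : Jᴴ * J = 1) : PiIsChannel (Φ ∘ₗ conjSnd J) := by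
  simpa using hΦ.comp_sum_conjSnd (fun _ : Unit => J) (by simpa using hJ)

/-- Kraus operators of a channel reversing conjugation by the isometry `J`: the compression to the
range of `J`, and operators sending the complement of this range to the basis vector `z`. -/
def recoveryKraus [Fintype t] [DecidableEq t] [Fintype τ] [DecidableEq τ] (J : Matrix τ t ℂ)
    (z : t) : Option τ → Matrix t τ ℂ
  | none => Jᴴ
  | some l => Matrix.single z l (1 : ℂ) * (1 - J * Jᴴ)

section

variable [Fintype t] [DecidableEq t] [Fintype τ] [DecidableEq τ] {J : Matrix τ t ℂ}

lemma sum_recoveryKraus (hJ : Jᴴ * J = 1) (z : t) :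
    ∑ e, (recoveryKraus J z e)ᴴ * recoveryKraus J z e = 1 := by
  have hP : (1 - J * Jᴴ) * (1 - J * Jᴴ) = 1 - J * Jᴴ := by
    have : J * Jᴴ * (J * Jᴴ) = J * Jᴴ := by
      rw [Matrix.mul_assoc, ← Matrix.mul_assoc Jᴴ, hJ, Matrix.one_mul]
    rw [Matrix.sub_mul, Matrix.mul_sub, Matrix.mul_sub, this]
    simp
  have hsum : ∑ l : τ, Matrix.single l l (1 : ℂ) = 1 := by
    ext p q
    simp [Matrix.sum_apply, Matrix.single_apply, Matrix.one_apply, ite_and]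
  have hterm : ∀ l, (recoveryKraus J z (some l))ᴴ * recoveryKraus J z (some l) =
      (1 - J * Jᴴ) * Matrix.single l l (1 : ℂ) * (1 - J * Jᴴ) := by
    intro l
    have hs : (Matrix.single z l (1 : ℂ))ᴴ * Matrix.single z l (1 : ℂ) = Matrix.single l l 1 := by
      simp [Matrix.conjTranspose_single]
    rw [← hs]
    simp only [recoveryKraus, conjTranspose_mul, conjTranspose_sub, conjTranspose_one,
      conjTranspose_conjTranspose, Matrix.mul_assoc]
  rw [Fintype.sum_option, Finset.sum_congr rfl fun l _ => hterm l, ← Matrix.sum_mul,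
    ← Matrix.mul_sum, hsum, Matrix.mul_one, hP]
  simp [recoveryKraus]

lemma sum_conjSnd_recoveryKraus_comp [∀ i, Fintype (A i)] [∀ i, DecidableEq (A i)]
    (hJ : Jᴴ * J = 1) (z : t) :
    (∑ e, conjSnd (A := A) (recoveryKraus J z e)) ∘ₗ conjSnd J = LinearMap.id := by
  refine LinearMap.ext fun X => funext fun i => ?_
  have hmul : ∀ K : Matrix t τ ℂ, conjSnd K (conjSnd J X) i =
      ((1 : Mat (A i)) ⊗ₖ (K * J)) * X i * ((1 : Mat (A i)) ⊗ₖ (K * J))ᴴ := by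
    intro K
    have h : (1 : Mat (A i)) ⊗ₖ (K * J) = ((1 : Mat (A i)) ⊗ₖ K) * ((1 : Mat (A i)) ⊗ₖ J) := by
      rw [← mul_kronecker_mul, Matrix.one_mul]
    rw [conjSnd_apply, conjSnd_apply, h, conjTranspose_mul]
    simp only [Matrix.mul_assoc]
  have hzero : ∀ l, recoveryKraus J z (some l) * J = 0 := by
    intro l
    simp [recoveryKraus, Matrix.mul_assoc, Matrix.sub_mul, hJ]
  have hone : recoveryKraus J z none * J = 1 := hJ
  simp [LinearMap.sum_apply, Finset.sum_apply, hmul, Fintype.sum_option, hzero, hone]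

end

section

variable {p q r : Type} [Fintype q] [Fintype r] [DecidableEq r]

lemma mul_conjTranspose_mul_of_range_le [Fintype p] [DecidableEq q] 
    {J : Matrix p r ℂ} (hJ : Jᴴ * J = 1)
    {ω : Matrix p q ℂ}
    (h : LinearMap.range ω.mulVecLin ≤ LinearMap.range J.mulVecLin) : J * Jᴴ * ω = ω := by
  refine Matrix.ext_of_mulVec_single fun k => ?_
  obtain ⟨y, hy⟩ := h ⟨Pi.single k 1, rfl⟩
  simp only [mulVecLin_apply] at hy
  rw [← mulVec_mulVec, ← hy, mulVec_mulVec, Matrix.mul_assoc, hJ, Matrix.mul_one]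

lemma mul_conjTranspose_mul_of_ker_le [DecidableEq q] {Q : Matrix r q ℂ} (hQ : Q * Qᴴ = 1)
    {ω : Matrix p q ℂ}
    (h : LinearMap.ker Q.mulVecLin ≤ LinearMap.ker ω.mulVecLin) : ω * (Qᴴ * Q) = ω := by
  refine Matrix.ext_of_mulVec_single fun k => ?_
  have hk : Pi.single k 1 - (Qᴴ * Q) *ᵥ Pi.single k 1 ∈ LinearMap.ker ω.mulVecLin := by
    apply h
    rw [LinearMap.mem_ker, mulVecLin_apply, mulVec_sub, mulVec_mulVec, ← Matrix.mul_assoc, hQ,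
      Matrix.one_mul, sub_self]
  rw [LinearMap.mem_ker, mulVecLin_apply, mulVec_sub, mulVec_mulVec, sub_eq_zero] at hk
  exact hk.symm

lemma isUnit_of_card_le_rank {η : Matrix r r ℂ} (h : Fintype.card r ≤ η.rank) : IsUnit η := by
  rw [← mulVec_surjective_iff_isUnit]
  have htop : LinearMap.range η.mulVecLin = ⊤ := by
    apply Submodule.eq_top_of_finrank_eq
    rw [Module.finrank_fintype_fun_eq_card]
    exact le_antisymm η.rank_le_card_width h
  exact LinearMap.range_eq_top.mp htop

lemma trace_conjTranspose_mul_self_mul_mul [Fintype p] {s : Type} [Fintype s] [DecidableEq s]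
    {J : Matrix p r ℂ} (hJ : Jᴴ * J = 1) {Q : Matrix s q ℂ} (hQ : Q * Qᴴ = 1)
    (η : Matrix r s ℂ) : ((J * η * Q)ᴴ * (J * η * Q)).trace = (ηᴴ * η).trace := by
  calc ((J * η * Q)ᴴ * (J * η * Q)).trace = (Qᴴ * (ηᴴ * (Jᴴ * J) * η * Q)).trace := by
        simp only [conjTranspose_mul, Matrix.mul_assoc]
    _ = (ηᴴ * η).trace := by
        rw [trace_mul_comm, hJ, Matrix.mul_one, Matrix.mul_assoc, hQ, Matrix.mul_one]

end

/-- **Reduction of entanglement-reversibility to the case of an invertible pure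
resource state.** Decomposing a nonzero `ω : ℂ^{h₁} → ℂ^{h₂}` as `ω = J ω̄ Q` with
`J` an isometry onto the range of `ω`, `Q` a coisometry whose kernel is `ker ω`
(so that `Q†Q` is the orthogonal projection onto `(ker ω)ᗮ`), and
`ω̄ = J† ω Q†` invertible, the channel `M` is entanglement-reversible
(resp. -invertible) with respect to `W_ω` iff the restricted channel
`M̄ : x ⊗ σ ↦ M(x ⊗ Qᵀ σ (Qᵀ)†)` is entanglement-reversible (resp. -invertible)
with respect to `W_ω̄`. -/
theorem reduction_to_invertible_pure_state
    {m n : ℕ} (a : Fin m → ℕ) (b : Fin n → ℕ)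
    (ha : ∀ i, 1 ≤ a i) (hb : ∀ j, 1 ≤ b j)
    (h₁ h₂ : ℕ) (hh₁ : 1 ≤ h₁) (hh₂ : 1 ≤ h₂)
    (ω : Matrix (Fin h₂) (Fin h₁) ℂ) (hω0 : ω ≠ 0) (hωtr : (ωᴴ * ω).trace = 1)
    (J : Matrix (Fin h₂) (Fin ω.rank) ℂ)
    (hJiso : Jᴴ * J = 1)
    (hJrange : LinearMap.range J.mulVecLin = LinearMap.range ω.mulVecLin)
    (Q : Matrix (Fin ω.rank) (Fin h₁) ℂ)
    (hQcoiso : Q * Qᴴ = 1)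
    (hQker : LinearMap.ker Q.mulVecLin = LinearMap.ker ω.mulVecLin)
    (M : ((i : Fin m) → Mat (Fin (a i) × Fin h₁)) →ₗ[ℂ] (j : Fin n) → Mat (Fin (b j)))
    (hM : PiIsChannel M) :
    IsUnit (Jᴴ * ω * Qᴴ) ∧
    ((Jᴴ * ω * Qᴴ)ᴴ * (Jᴴ * ω * Qᴴ)).trace = 1 ∧
    ω = J * (Jᴴ * ω * Qᴴ) * Q ∧
    (PiEntReversible M (pureState ω) ↔
      PiEntReversible
        (M ∘ₗ LinearMap.pi fun i =>
          conjBy ((1 : Mat (Fin (a i))) ⊗ₖ Qᵀ) ∘ₗ LinearMap.proj i)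
        (pureState (Jᴴ * ω * Qᴴ))) ∧
    (PiEntInvertible M (pureState ω) ↔
      PiEntInvertible
        (M ∘ₗ LinearMap.pi fun i =>
          conjBy ((1 : Mat (Fin (a i))) ⊗ₖ Qᵀ) ∘ₗ LinearMap.proj i)
        (pureState (Jᴴ * ω * Qᴴ))) := by
  have hω : ω = J * (Jᴴ * ω * Qᴴ) * Q := by
    have hJω := mul_conjTranspose_mul_of_range_le hJiso hJrange.ge
    have hωQ := mul_conjTranspose_mul_of_ker_le hQcoiso hQker.le
    calc ω = J * Jᴴ * ω * (Qᴴ * Q) := by rw [hJω, hωQ]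
      _ = J * (Jᴴ * ω * Qᴴ) * Q := by simp only [Matrix.mul_assoc]
  have hrank : 0 < ω.rank := by
    by_contra h0
    have : IsEmpty (Fin ω.rank) := by
      rw [Nat.eq_zero_of_not_pos h0]
      infer_instance
    apply hω0
    rw [hω]
    ext k l
    simp [Matrix.mul_apply]
  have hunit : IsUnit (Jᴴ * ω * Qᴴ) := by
    apply isUnit_of_card_le_rank
    rw [Fintype.card_fin]
    calc ω.rank = (J * (Jᴴ * ω * Qᴴ) * Q).rank := congrArg Matrix.rank hω
      _ ≤ (Jᴴ * ω * Qᴴ).rank := (rank_mul_le_left _ _).trans (rank_mul_le_right _ _)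
  refine ⟨hunit, ?_, hω, ?_⟩
  · generalize Jᴴ * ω * Qᴴ = η at hω
    rw [← trace_conjTranspose_mul_self_mul_mul hJiso hQcoiso, ← hω, hωtr]
  generalize Jᴴ * ω * Qᴴ = η at hω
  change (_ ↔ PiEntReversible (M ∘ₗ conjSnd Qᵀ) (pureState η)) ∧
    (_ ↔ PiEntInvertible (M ∘ₗ conjSnd Qᵀ) (pureState η))
  have hleft := fun N => piEntLeftInv_mul_mul_iff M N J η Q
  have hright := fun N => piEntRightInv_mul_mul_iff M N J η Q
  rw [← hω] at hleft hright
  have hrecover := fun N : ((j : Fin n) → Mat (Fin (b j) × Fin ω.rank)) →ₗ[ℂ]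
      (i : Fin m) → Mat (Fin (a i)) =>
    show (N ∘ₗ ∑ e, conjSnd (recoveryKraus J ⟨0, hrank⟩ e)) ∘ₗ conjSnd J = N by
      rw [LinearMap.comp_assoc, sum_conjSnd_recoveryKraus_comp hJiso, LinearMap.comp_id]
  have hchannel := sum_recoveryKraus hJiso ⟨0, hrank⟩
  refine ⟨⟨?_, ?_⟩, ⟨?_, ?_⟩⟩
  · rintro ⟨N, hN, hl⟩
    exact ⟨_, hN.comp_conjSnd hJiso, (hleft N).1 hl⟩
  · rintro ⟨N, hN, hl⟩
    exact ⟨_, hN.comp_sum_conjSnd _ hchannel, (hleft _).2 (by rwa [hrecover])⟩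
  · rintro ⟨N, hN, hl, hr⟩
    exact ⟨_, hN.comp_conjSnd hJiso, (hleft N).1 hl, (hright N).1 hr⟩
  · rintro ⟨N, hN, hl, hr⟩
    exact ⟨_, hN.comp_sum_conjSnd _ hchannel, (hleft _).2 (by rwa [hrecover]),
      (hright _).2 (by rwa [hrecover])⟩

end EntInvPaper
end
end
end
end
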